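/- arXiv:2006.01876 — 2 statements merged into one kernel-verified Lean document; each statement's English description precedes it below -/
import Mathlib

section
/- Let ε = e^{2πi/5}, u_5(x,y) = x^8 + x^7y + 7x^6y^2 − 7x^5y^3 + 7x^3y^5 + 7x^2y^6 − xy^7 + y^8, and for k = 1,…,5 set u_k(x,y) = u_5(ε^{3k}x, ε^{2k}y). Then the sum u_1 + u_2 + u_3 + u_4 + u_5 is the zero polynomial in ℂ[x,y]. -/
open MvPolynomial

noncomputable def ε : ℂ := Complex.exp (2 * Real.pi * Complex.I / 5)

noncomputable def u5 : MvPolynomial (Fin 2) ℂ :=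
  (X 0) ^ 8 + (X 0) ^ 7 * X 1 + 7 * (X 0) ^ 6 * (X 1) ^ 2 - 7 * (X 0) ^ 5 * (X 1) ^ 3
    + 7 * (X 0) ^ 3 * (X 1) ^ 5 + 7 * (X 0) ^ 2 * (X 1) ^ 6 - X 0 * (X 1) ^ 7 + (X 1) ^ 8

/-- `u k` is `u5(ε^(3k) x, ε^(2k) y)`. -/
noncomputable def u (k : ℕ) : MvPolynomial (Fin 2) ℂ :=
  aeval ![C (ε ^ (3 * k)) * X 0, C (ε ^ (2 * k)) * X 1] u5

theorem isPrimitiveRoot_ε : IsPrimitiveRoot ε 5 := by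
  simpa [ε] using Complex.isPrimitiveRoot_exp 5 (by norm_num)

/-- Scaling `u5` by `(z ^ 3, z ^ 2)` with `z ^ 5 = 1` multiplies the monomial `x ^ a * y ^ (8 - a)`
by `z ^ (a + 1)`; no monomial has a trivial factor. -/
theorem aeval_u5_of_pow_five_eq_one {R : Type*} [CommRing R] [Algebra ℂ R] {z : R}
    (hz : z ^ 5 = 1) (x y : R) :
    aeval ![z ^ 3 * x, z ^ 2 * y] u5 =
      z ^ 4 * (x ^ 8 + 7 * x ^ 3 * y ^ 5) + z ^ 3 * (x ^ 7 * y + 7 * x ^ 2 * y ^ 6)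
        + z ^ 2 * (7 * x ^ 6 * y ^ 2 - x * y ^ 7) + z * (y ^ 8 - 7 * x ^ 5 * y ^ 3) := by
  have reduce (n m : ℕ) : z ^ (5 * n + m) = z ^ m := by rw [pow_add, pow_mul, hz, one_pow, one_mul]
  have h24 : z ^ 24 = z ^ 4 := reduce 4 4
  have h23 : z ^ 23 = z ^ 3 := reduce 4 3
  have h22 : z ^ 22 = z ^ 2 := reduce 4 2
  have h21 : z ^ 21 = z := by simpa using reduce 4 1
  have h19 : z ^ 19 = z ^ 4 := reduce 3 4
  have h18 : z ^ 18 = z ^ 3 := reduce 3 3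
  have h17 : z ^ 17 = z ^ 2 := reduce 3 2
  have h16 : z ^ 16 = z := by simpa using reduce 3 1
  simp only [u5, map_add, map_sub, map_mul, map_pow, map_ofNat, aeval_X, Matrix.cons_val_zero,
    Matrix.cons_val_one]
  linear_combination x ^ 8 * h24 + x ^ 7 * y * h23 + 7 * x ^ 6 * y ^ 2 * h22
    - 7 * x ^ 5 * y ^ 3 * h21 + 7 * x ^ 3 * y ^ 5 * h19 + 7 * x ^ 2 * y ^ 6 * h18
    - x * y ^ 7 * h17 + y ^ 8 * h16

theorem u_eq (k : ℕ) :
    u k = C (ε ^ k) ^ 4 * (X 0 ^ 8 + 7 * X 0 ^ 3 * X 1 ^ 5)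
      + C (ε ^ k) ^ 3 * (X 0 ^ 7 * X 1 + 7 * X 0 ^ 2 * X 1 ^ 6)
      + C (ε ^ k) ^ 2 * (7 * X 0 ^ 6 * X 1 ^ 2 - X 0 * X 1 ^ 7)
      + C (ε ^ k) * (X 1 ^ 8 - 7 * X 0 ^ 5 * X 1 ^ 3) := by
  have hz : (C (ε ^ k) : MvPolynomial (Fin 2) ℂ) ^ 5 = 1 := by
    rw [← C_pow, pow_right_comm, isPrimitiveRoot_ε.pow_eq_one, one_pow, C_1]
  rw [← aeval_u5_of_pow_five_eq_one hz, u, mul_comm 3, mul_comm 2]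
  simp only [pow_mul, C_pow]

theorem sum_pow_ε (j : ℕ) (hj : ¬ 5 ∣ j) :
    (ε ^ 1) ^ j + (ε ^ 2) ^ j + (ε ^ 3) ^ j + (ε ^ 4) ^ j + (ε ^ 5) ^ j = 0 := by
  have h := (isPrimitiveRoot_ε.pow_of_coprime j
    ((Nat.Prime.coprime_iff_not_dvd Nat.prime_five).2 hj).symm).geom_sum_eq_zero (by norm_num)
  simp only [Finset.sum_range_succ, Finset.sum_range_zero] at h
  simp only [← pow_mul, mul_comm _ j]
  simp only [pow_mul] at h ⊢
  linear_combination ε ^ j * h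

theorem sum_u_eq_zero : u 1 + u 2 + u 3 + u 4 + u 5 = 0 := by
  have h (j : ℕ) (hj : ¬ 5 ∣ j) := congrArg (C (σ := Fin 2)) (sum_pow_ε j hj)
  simp only [C_add, C_pow, C_0] at h
  simp only [u_eq, C_pow]
  linear_combination (X 0 ^ 8 + 7 * X 0 ^ 3 * X 1 ^ 5) * h 4 (by norm_num)
    + (X 0 ^ 7 * X 1 + 7 * X 0 ^ 2 * X 1 ^ 6) * h 3 (by norm_num)
    + (7 * X 0 ^ 6 * X 1 ^ 2 - X 0 * X 1 ^ 7) * h 2 (by norm_num)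
    + (X 1 ^ 8 - 7 * X 0 ^ 5 * X 1 ^ 3) * h 1 (by norm_num)
end

section
/- Let ε = e^{2πi/5}, u_5(x,y) = x^8 + x^7y + 7x^6y^2 − 7x^5y^3 + 7x^3y^5 + 7x^2y^6 − xy^7 + y^8, and for k = 1,…,5 set u_k(x,y) = u_5(ε^{3k}x, ε^{2k}y). Let F(x,y) = x·y·(x^10 − 11x^5y^5 − y^10) and H(x,y) = x^20 + 228x^15y^5 + 494x^10y^10 − 228x^5y^15 + y^20. Suppose (a,b) ∈ ℂ^2 satisfies H(a,b) ≠ 0, and set Z_0 = F(a,b)^5 / H(a,b)^3. Then for each k = 1,…,5, the complex number ρ_k = F(a,b)·u_k(a,b)/H(a,b) satisfies ρ_k^5 − 40·Z_0·ρ_k^2 − 5·Z_0·ρ_k − Z_0 = 0. -/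
def Ffun (a b : ℂ) : ℂ := a * b * (a ^ 10 - 11 * a ^ 5 * b ^ 5 - b ^ 10)

def Hfun (a b : ℂ) : ℂ :=
  a ^ 20 + 228 * a ^ 15 * b ^ 5 + 494 * a ^ 10 * b ^ 10 - 228 * a ^ 5 * b ^ 15 + b ^ 20

def u5fun (a b : ℂ) : ℂ :=
  a ^ 8 + a ^ 7 * b + 7 * a ^ 6 * b ^ 2 - 7 * a ^ 5 * b ^ 3
    + 7 * a ^ 3 * b ^ 5 + 7 * a ^ 2 * b ^ 6 - a * b ^ 7 + b ^ 8

noncomputable def ufun (k : ℕ) (a b : ℂ) : ℂ := u5fun (ε ^ (3 * k) * a) (ε ^ (2 * k) * b)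

theorem ε_pow_five : ε ^ 5 = 1 := by
  rw [ε, ← Complex.exp_nat_mul, ← Complex.exp_two_pi_mul_I]
  congr 1
  push_cast
  ring

/-- `Ffun` depends only on `a * b`, `a ^ 5` and `b ^ 5`. -/
theorem Ffun_congr {a b x y : ℂ} (hxy : x * y = a * b) (hx : x ^ 5 = a ^ 5)
    (hy : y ^ 5 = b ^ 5) : Ffun x y = Ffun a b := by
  have e (s t : ℂ) : Ffun s t =
      s * t * ((s ^ 5) ^ 2 - 11 * s ^ 5 * t ^ 5 - (t ^ 5) ^ 2) := by
    unfold Ffun; ring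
  rw [e, e, hxy, hx, hy]

/-- `Hfun` depends only on `a ^ 5` and `b ^ 5`. -/
theorem Hfun_congr {a b x y : ℂ} (hx : x ^ 5 = a ^ 5) (hy : y ^ 5 = b ^ 5) :
    Hfun x y = Hfun a b := by
  have e (s t : ℂ) : Hfun s t =
      (s ^ 5) ^ 4 + 228 * (s ^ 5) ^ 3 * t ^ 5 + 494 * (s ^ 5) ^ 2 * (t ^ 5) ^ 2
        - 228 * s ^ 5 * (t ^ 5) ^ 3 + (t ^ 5) ^ 4 := by
    unfold Hfun; ring
  rw [e, e, hx, hy]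

/-- The homogeneous quintic relation between `u5fun`, `Ffun` and `Hfun`. -/
theorem u5fun_quintic (a b : ℂ) :
    u5fun a b ^ 5 - 40 * Ffun a b ^ 2 * u5fun a b ^ 2
      - 5 * Ffun a b * Hfun a b * u5fun a b - Hfun a b ^ 2 = 0 := by
  unfold u5fun Ffun Hfun
  ring

theorem ufun_quintic (k : ℕ) (a b : ℂ) :
    ufun k a b ^ 5 - 40 * Ffun a b ^ 2 * ufun k a b ^ 2
      - 5 * Ffun a b * Hfun a b * ufun k a b - Hfun a b ^ 2 = 0 := by
  have hpow (n : ℕ) : (ε ^ (n * k)) ^ 5 = 1 := by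
    rw [← pow_mul, mul_comm, pow_mul, ε_pow_five, one_pow]
  have hx : (ε ^ (3 * k) * a) ^ 5 = a ^ 5 := by rw [mul_pow, hpow, one_mul]
  have hy : (ε ^ (2 * k) * b) ^ 5 = b ^ 5 := by rw [mul_pow, hpow, one_mul]
  have hxy : ε ^ (3 * k) * a * (ε ^ (2 * k) * b) = a * b := by
    rw [mul_mul_mul_comm, ← pow_add, ← add_mul, pow_mul, ε_pow_five, one_pow, one_mul]
  rw [← Ffun_congr hxy hx hy, ← Hfun_congr hx hy]
  exact u5fun_quintic _ _

theorem rho_k_is_root_of_resolvent (a b : ℂ) (hH : Hfun a b ≠ 0)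
    (k : ℕ) (hk1 : 1 ≤ k) (hk5 : k ≤ 5) :
    (Ffun a b * ufun k a b / Hfun a b) ^ 5
      - 40 * (Ffun a b ^ 5 / Hfun a b ^ 3) * (Ffun a b * ufun k a b / Hfun a b) ^ 2
      - 5 * (Ffun a b ^ 5 / Hfun a b ^ 3) * (Ffun a b * ufun k a b / Hfun a b)
      - Ffun a b ^ 5 / Hfun a b ^ 3 = 0 := by
  have key := ufun_quintic k a b
  generalize Ffun a b = F, Hfun a b = H, ufun k a b = u at *
  calc
    _ = F ^ 5 / H ^ 5 * (u ^ 5 - 40 * F ^ 2 * u ^ 2 - 5 * F * H * u - H ^ 2) := by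
      field_simp
    _ = 0 := by rw [key, mul_zero]
end
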